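/- Let F_11 be the simple graph on vertex set {v_1, ..., v_11} with edge set {v_1v_2, v_1v_6, v_1v_9, v_2v_3, v_2v_5, v_2v_7, v_3v_4, v_3v_6, v_3v_8, v_4v_7, v_4v_10, v_5v_9, v_5v_6, v_6v_7, v_6v_11, v_7v_8, v_7v_11, v_8v_10, v_9v_11, v_10v_11}. Then F_11 has 20 edges and F_11 → (P_3, C_11). -/

import Mathlib

open SimpleGraph

/-- `F` contains a copy of `G` (an injective graph homomorphism from `G` to `F`). -/
def Contains {α β : Type*} (F : SimpleGraph α) (G : SimpleGraph β) : Prop :=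
  ∃ f : G →g F, Function.Injective f

/-- `F → (G, H)`: for every red/blue coloring of the edges of `F` (given by the spanning
subgraph `R ≤ F` of red edges, the other edges of `F` being blue), there is a red copy of `G`
or a blue copy of `H`. -/
def Arrows {α β γ : Type*} (F : SimpleGraph α) (G : SimpleGraph β) (H : SimpleGraph γ) : Prop :=
  ∀ R : SimpleGraph α, R ≤ F → Contains R G ∨ Contains (F \ R) H

/-- The graph `F₁₁` (vertex `vᵢ` of the paper is `i - 1 : Fin 11`). -/
def F11 : SimpleGraph (Fin 11) :=
  fromEdgeSet {s(0,1), s(0,5), s(0,8), s(1,2), s(1,4), s(1,6), s(2,3), s(2,5), s(2,7),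
    s(3,6), s(3,9), s(4,8), s(4,5), s(5,6), s(5,10), s(6,7), s(6,10), s(7,9), s(8,10), s(9,10)}

/-- The Hamiltonian cycles of `F11`, as vertex lists. -/
def hamCycles : List (List (Fin 11)) :=
  [[0, 1, 2, 3, 6, 7, 9, 10, 5, 4, 8],
   [0, 1, 2, 3, 6, 7, 9, 10, 8, 4, 5],
   [0, 1, 2, 3, 9, 7, 6, 10, 5, 4, 8],
   [0, 1, 2, 3, 9, 7, 6, 10, 8, 4, 5],
   [0, 1, 2, 7, 6, 3, 9, 10, 5, 4, 8],
   [0, 1, 2, 7, 6, 3, 9, 10, 8, 4, 5],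
   [0, 1, 2, 7, 9, 3, 6, 10, 5, 4, 8],
   [0, 1, 2, 7, 9, 3, 6, 10, 8, 4, 5],
   [0, 1, 4, 5, 2, 3, 6, 7, 9, 10, 8],
   [0, 1, 4, 5, 2, 3, 9, 7, 6, 10, 8],
   [0, 1, 4, 5, 2, 7, 6, 3, 9, 10, 8],
   [0, 1, 4, 5, 2, 7, 9, 3, 6, 10, 8],
   [0, 1, 4, 5, 6, 3, 2, 7, 9, 10, 8],
   [0, 1, 4, 5, 6, 7, 2, 3, 9, 10, 8],
   [0, 1, 4, 8, 10, 6, 3, 9, 7, 2, 5],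
   [0, 1, 4, 8, 10, 6, 7, 9, 3, 2, 5],
   [0, 1, 4, 8, 10, 9, 3, 2, 7, 6, 5],
   [0, 1, 4, 8, 10, 9, 3, 6, 7, 2, 5],
   [0, 1, 4, 8, 10, 9, 7, 2, 3, 6, 5],
   [0, 1, 4, 8, 10, 9, 7, 6, 3, 2, 5],
   [0, 1, 6, 3, 2, 7, 9, 10, 5, 4, 8],
   [0, 1, 6, 3, 2, 7, 9, 10, 8, 4, 5],
   [0, 1, 6, 7, 2, 3, 9, 10, 5, 4, 8],
   [0, 1, 6, 7, 2, 3, 9, 10, 8, 4, 5],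
   [0, 5, 4, 1, 2, 3, 6, 7, 9, 10, 8],
   [0, 5, 4, 1, 2, 3, 9, 7, 6, 10, 8],
   [0, 5, 4, 1, 2, 7, 6, 3, 9, 10, 8],
   [0, 5, 4, 1, 2, 7, 9, 3, 6, 10, 8],
   [0, 5, 4, 1, 6, 3, 2, 7, 9, 10, 8],
   [0, 5, 4, 1, 6, 7, 2, 3, 9, 10, 8],
   [0, 5, 10, 6, 3, 9, 7, 2, 1, 4, 8],
   [0, 5, 10, 6, 7, 9, 3, 2, 1, 4, 8],
   [0, 5, 10, 9, 3, 2, 7, 6, 1, 4, 8],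
   [0, 5, 10, 9, 3, 6, 7, 2, 1, 4, 8],
   [0, 5, 10, 9, 7, 2, 3, 6, 1, 4, 8],
   [0, 5, 10, 9, 7, 6, 3, 2, 1, 4, 8]]

/-- The `i`-th vertex of a cycle. -/
def vtx (c : List (Fin 11)) (i : Fin 11) : Fin 11 := c.getD i.val 0

def cycEdges (c : List (Fin 11)) : List (Fin 11 × Fin 11) :=
  (List.finRange 11).map fun i => (vtx c i, vtx c (i + 1))

/-- Distinct edges sharing an endpoint. -/
def conflict (e f : Fin 11 × Fin 11) : Bool :=
  (e.1 == f.1 && e.2 != f.2) || (e.1 == f.2 && e.2 != f.1) ||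
  (e.2 == f.1 && e.1 != f.2) || (e.2 == f.2 && e.1 != f.1)

def sameEdge (e f : Fin 11 × Fin 11) : Bool :=
  (e.1 == f.1 && e.2 == f.2) || (e.1 == f.2 && e.2 == f.1)

/-- Branch on which edge of a cycle avoiding the current red edges is red. -/
def search : ℕ → List (Fin 11 × Fin 11) → Bool
  | 0, _ => false
  | n + 1, red =>
    match hamCycles.find? (fun c => (cycEdges c).all fun e => red.all fun f => !sameEdge e f) with
    | none => false
    | some c => (cycEdges c).all fun e => red.any (conflict e) || search n (e :: red)

theorem search_sound (P : Fin 11 × Fin 11 → Prop)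
    (hP : ∀ e f, P e → P f → conflict e f = false) :
    ∀ n red, (∀ e ∈ red, P e) → search n red = true →
      ∃ c ∈ hamCycles, ∀ e ∈ cycEdges c, ¬ P e := by
  intro n
  induction n with
  | zero => intro red _ h; simp [search] at h
  | succ n ih =>
    intro red hred h
    rw [search] at h
    split at h
    · simp at h
    · rename_i c hc
      by_contra! hcon
      obtain ⟨e, he, hPe⟩ := hcon c (List.mem_of_find?_eq_some hc)
      have h1 := List.all_eq_true.mp h e he
      rw [Bool.or_eq_true] at h1
      rcases h1 with h1 | h1
      · obtain ⟨f, hf, hcf⟩ := List.any_eq_true.mp h1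
        rw [hP e f hPe (hred f hf)] at hcf
        exact absurd hcf (by simp)
      · obtain ⟨c', hc', hn⟩ := ih (e :: red) (by
          intro f hf
          rcases List.mem_cons.mp hf with rfl | hf
          · exact hPe
          · exact hred f hf) h1
        obtain ⟨f, hf, hPf⟩ := hcon c' hc'
        exact hn f hf hPf

def edgeFin : Finset (Sym2 (Fin 11)) :=
  {s(0,1), s(0,5), s(0,8), s(1,2), s(1,4), s(1,6), s(2,3), s(2,5), s(2,7),
    s(3,6), s(3,9), s(4,8), s(4,5), s(5,6), s(5,10), s(6,7), s(6,10), s(7,9), s(8,10), s(9,10)}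

theorem F11_edgeSet : F11.edgeSet = (edgeFin : Set (Sym2 (Fin 11))) := by
  have hd : ∀ e ∈ edgeFin, ¬ e.IsDiag := by decide
  have : F11 = fromEdgeSet (edgeFin : Set (Sym2 (Fin 11))) := by
    unfold F11 edgeFin; congr 1; simp
  rw [this, edgeSet_fromEdgeSet]
  ext e
  simp only [Set.mem_sdiff, Finset.mem_coe]
  exact ⟨fun h => h.1, fun h => ⟨h, hd e h⟩⟩

set_option maxRecDepth 100000 in
theorem search_true : search 7 [] = true := by decide +kernel

theorem hamCycles_ok : ∀ c ∈ hamCycles,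
    (∀ i j, vtx c i = vtx c j → i = j) ∧ ∀ i, s(vtx c i, vtx c (i + 1)) ∈ edgeFin := by
  decide +kernel

theorem contains_path {R : SimpleGraph (Fin 11)} {a b c : Fin 11} (h1 : R.Adj a b)
    (h2 : R.Adj a c) (hbc : b ≠ c) : Contains R (pathGraph 3) := by
  refine ⟨⟨![b, a, c], ?_⟩, ?_⟩
  · intro i j hij
    rw [pathGraph_adj] at hij
    fin_cases i <;> fin_cases j <;> simp_all [R.adj_comm]
  · intro i j hij
    have := h1.ne
    have := h2.ne
    fin_cases i <;> fin_cases j <;> simp_all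

theorem stmt_16 : F11.edgeSet.ncard = 20 ∧ Arrows F11 (pathGraph 3) (cycleGraph 11) := by
  refine ⟨?_, ?_⟩
  · rw [F11_edgeSet, Set.ncard_coe_finset]; decide
  intro R _
  by_cases hR : Contains R (pathGraph 3)
  · exact Or.inl hR
  right
  have key : ∀ a b c, R.Adj a b → R.Adj a c → b = c := by
    intro a b c h1 h2
    by_contra h
    exact hR (contains_path h1 h2 h)
  obtain ⟨c, hc, hn⟩ := search_sound (fun e => R.Adj e.1 e.2) (by
    rintro ⟨a, b⟩ ⟨x, y⟩ h1 h2
    simp only at h1 h2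
    simp only [conflict, Bool.or_eq_false_iff, Bool.and_eq_false_iff, beq_eq_false_iff_ne,
      bne_eq_false_iff_eq]
    refine ⟨⟨⟨?_, ?_⟩, ?_⟩, ?_⟩ <;> rw [or_iff_not_imp_left, not_not] <;> rintro rfl
    · exact key _ _ _ h1 h2
    · exact key _ _ _ h1 h2.symm
    · exact key _ _ _ h1.symm h2
    · exact key _ _ _ h1.symm h2.symm) 7 [] (by simp) search_true
  obtain ⟨hinj, hadj⟩ := hamCycles_ok c hc
  have step : ∀ i, (F11 \ R).Adj (vtx c i) (vtx c (i + 1)) := by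
    intro i
    rw [sdiff_adj]
    refine ⟨?_, hn (vtx c i, vtx c (i + 1)) (List.mem_map.mpr ⟨i, List.mem_finRange i, rfl⟩)⟩
    rw [← mem_edgeSet, F11_edgeSet]
    exact hadj i
  refine ⟨⟨vtx c, ?_⟩, fun i j h => hinj i j h⟩
  intro i j hij
  rw [cycleGraph_adj] at hij
  rcases hij with h | h
  · rw [sub_eq_iff_eq_add'.mp h]
    exact (step j).symm
  · rw [sub_eq_iff_eq_add'.mp h]
    exact step i
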